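/- Let N ≥ 1, let u, v : ℝ^N → ℝ be Borel measurable functions vanishing at infinity, and let p be a real number with 1 ≤ p < ∞. Then ∫_{ℝ^N} ({u,v}⋆(x))^p dx = ∫_{ℝ^N} |u(x)|^p dx + ∫_{ℝ^N} |v(x)|^p dx, as an identity of extended nonnegative reals. -/

import Mathlib

open MeasureTheory ENNReal

noncomputable section

/-- Euclidean space `ℝ^N`. -/
abbrev EucN (N : ℕ) : Type := EuclideanSpace ℝ (Fin N)

/-- A function vanishes at infinity if all its strict superlevel sets (of positive level)
have finite Lebesgue measure. -/
def VanishesAtInfinity {N : ℕ} (w : EucN N → ℝ) : Prop :=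
  ∀ t : ℝ, 0 < t → volume {x : EucN N | t < |w x|} < ⊤

/-- `A⋆(u,v;t)`: the open ball centered at the origin whose Lebesgue measure equals
`|{|u| > t}| + |{|v| > t}|` (empty if that sum is `0`). -/
def Astar {N : ℕ} (u v : EucN N → ℝ) (t : ℝ) : Set (EucN N) :=
  {x : EucN N | volume (Metric.ball (0 : EucN N) ‖x‖) <
    volume {y : EucN N | t < |u y|} + volume {y : EucN N | t < |v y|}}

/-- The Shibata rearrangement `{u,v}⋆(x) = ∫₀^∞ χ_{A⋆(u,v;t)}(x) dt`. -/
def shibata {N : ℕ} (u v : EucN N → ℝ) (x : EucN N) : ℝ≥0∞ :=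
  ∫⁻ t in Set.Ioi (0 : ℝ), Set.indicator (Astar u v t) (fun _ => (1 : ℝ≥0∞)) x

theorem exists_gt_lt_measure_superlevel {α : Type*} [MeasurableSpace α] (μ : Measure α)
    (f : α → ℝ) (t : ℝ) {c : ℝ≥0∞} (hc : c < μ {y | t < f y}) :
    ∃ s, t < s ∧ c < μ {y | s < f y} := by
  have hmono : Monotone fun n : ℕ => {y | t + 1 / ((n : ℝ) + 1) < f y} := fun m n hmn y hy =>
    (add_le_add_right (Nat.one_div_le_one_div hmn) t).trans_lt hy
  have hunion : (⋃ n : ℕ, {y | t + 1 / ((n : ℝ) + 1) < f y}) = {y | t < f y} := by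
    ext y
    simp only [Set.mem_iUnion, Set.mem_ofPred_eq]
    constructor
    · rintro ⟨n, hn⟩
      exact (lt_add_of_pos_right t Nat.one_div_pos_of_nat).trans hn
    · intro hy
      obtain ⟨n, hn⟩ := exists_nat_one_div_lt (sub_pos.2 hy)
      exact ⟨n, by linarith⟩
  rw [← hunion, hmono.measure_iUnion, lt_iSup_iff] at hc
  obtain ⟨n, hn⟩ := hc
  exact ⟨t + 1 / ((n : ℝ) + 1), lt_add_of_pos_right t Nat.one_div_pos_of_nat, hn⟩

theorem tendsto_measure_superlevel_atTop {α : Type*} [MeasurableSpace α] (μ : Measure α)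
    {f : α → ℝ} (hf : Measurable f) (hfin : ∃ t, μ {y | t < f y} ≠ ∞) :
    Filter.Tendsto (fun t => μ {y | t < f y}) Filter.atTop (nhds 0) := by
  have h := tendsto_measure_iInter_atTop (μ := μ) (s := fun t : ℝ => {y | t < f y})
    (fun t => (measurableSet_lt measurable_const hf).nullMeasurableSet)
    (fun s t hst y hy => lt_of_le_of_lt hst hy) hfin
  have hempty : (⋂ t : ℝ, {y | t < f y}) = ∅ :=
    Set.eq_empty_of_forall_notMem fun y hy =>
      lt_irrefl (f y) (Set.mem_ofPred.1 (Set.mem_iInter.1 hy (f y)))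
  rwa [hempty, measure_empty] at h

theorem Astar_antitone {N : ℕ} (u v : EucN N → ℝ) : Antitone (Astar u v) := fun _ _ hst _ hx =>
  lt_of_lt_of_le hx (add_le_add (measure_mono fun _ hy => lt_of_le_of_lt hst hy)
    (measure_mono fun _ hy => lt_of_le_of_lt hst hy))

theorem exists_gt_mem_Astar {N : ℕ} {u v : EucN N → ℝ} {t : ℝ} {x : EucN N}
    (hx : x ∈ Astar u v t) : ∃ s, t < s ∧ x ∈ Astar u v s := by
  have hsum : ∀ r, volume {y | r < |u y|} + volume {y | r < |v y|} =
      (volume.map Sum.inl + volume.map Sum.inr : Measure (EucN N ⊕ EucN N))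
        {z | r < Sum.elim (fun y => |u y|) (fun y => |v y|) z} := fun r => by
    rw [Measure.add_apply,
      MeasurableEmbedding.map_apply ⟨Sum.inl_injective, measurable_inl, fun _ h => h.inl_image⟩,
      MeasurableEmbedding.map_apply ⟨Sum.inr_injective, measurable_inr, fun _ h => h.inr_image⟩]
    rfl
  rw [Astar, Set.mem_ofPred_eq, hsum] at hx
  obtain ⟨s, hts, hs⟩ := exists_gt_lt_measure_superlevel _ _ t hx
  refine ⟨s, hts, ?_⟩
  rw [Astar, Set.mem_ofPred_eq, hsum]
  exact hs

theorem shibata_eq_volume {N : ℕ} (u v : EucN N → ℝ) (x : EucN N) :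
    shibata u v x = volume ({t | x ∈ Astar u v t} ∩ Set.Ioi 0) := by
  have hmeas : MeasurableSet {t | x ∈ Astar u v t} :=
    Set.OrdConnected.measurableSet (IsLowerSet.ordConnected fun _ _ h hx => Astar_antitone u v h hx)
  rw [← Measure.restrict_apply hmeas, ← lintegral_indicator_one hmeas, shibata]
  rfl

theorem ofReal_lt_shibata_iff {N : ℕ} (u v : EucN N → ℝ) (x : EucN N) {t : ℝ} (ht : 0 ≤ t) :
    ENNReal.ofReal t < shibata u v x ↔ x ∈ Astar u v t := by
  rw [shibata_eq_volume]
  constructor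
  · contrapose!
    intro hx
    calc volume ({s | x ∈ Astar u v s} ∩ Set.Ioi 0) ≤ volume (Set.Ioo 0 t) :=
          measure_mono fun s hs =>
            ⟨hs.2, lt_of_not_ge fun hts => hx (Astar_antitone u v hts hs.1)⟩
      _ = ENNReal.ofReal t := by rw [Real.volume_Ioo, sub_zero]
  · intro hx
    obtain ⟨s, hts, hs⟩ := exists_gt_mem_Astar hx
    calc ENNReal.ofReal t < ENNReal.ofReal s :=
          (ENNReal.ofReal_lt_ofReal_iff (ht.trans_lt hts)).2 hts
      _ = volume (Set.Ioc 0 s) := by rw [Real.volume_Ioc, sub_zero]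
      _ ≤ volume ({r | x ∈ Astar u v r} ∩ Set.Ioi 0) :=
          measure_mono fun r hr => ⟨Astar_antitone u v hr.2 hs, hr.1⟩

theorem measurable_volume_ball_norm (N : ℕ) :
    Measurable fun x : EucN N => volume (Metric.ball (0 : EucN N) ‖x‖) :=
  (Monotone.measurable fun _ _ h => measure_mono (Metric.ball_subset_ball h) :
    Measurable fun r : ℝ => volume (Metric.ball (0 : EucN N) r)).comp measurable_norm

theorem measurable_shibata {N : ℕ} (u v : EucN N → ℝ) : Measurable (shibata u v) := by
  refine measurable_of_Ioi fun a => ?_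
  rcases eq_or_ne a ∞ with rfl | ha
  · simp
  · have h : shibata u v ⁻¹' Set.Ioi a = Astar u v a.toReal := by
      ext x
      rw [← ofReal_lt_shibata_iff u v x ENNReal.toReal_nonneg, ENNReal.ofReal_toReal ha]
      rfl
    rw [h]
    exact measurableSet_lt (measurable_volume_ball_norm N) measurable_const

theorem volume_setOf_volume_ball_norm_lt {N : ℕ} (hN : 1 ≤ N) {c : ℝ≥0∞} (hc : c ≠ ∞) :
    volume {x : EucN N | volume (Metric.ball (0 : EucN N) ‖x‖) < c} = c := by
  have : Nonempty (Fin N) := ⟨⟨0, hN⟩⟩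
  have hN0 : N ≠ 0 := by omega
  set ω := volume (Metric.ball (0 : EucN N) 1)
  have hω0 : ω ≠ 0 := (Metric.measure_ball_pos volume 0 one_pos).ne'
  have hω : ω ≠ ∞ := measure_ball_lt_top.ne
  have hball : ∀ r : ℝ, 0 ≤ r →
      volume (Metric.ball (0 : EucN N) r) = ENNReal.ofReal (r ^ N) * ω := fun r hr => by
    rw [Measure.addHaar_ball volume 0 hr, finrank_euclideanSpace_fin]
  set R : ℝ := (c / ω).toReal ^ (N : ℝ)⁻¹
  have hR : 0 ≤ R := Real.rpow_nonneg ENNReal.toReal_nonneg _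
  have hRc : volume (Metric.ball (0 : EucN N) R) = c := by
    rw [hball R hR, Real.rpow_inv_natCast_pow ENNReal.toReal_nonneg hN0,
      ENNReal.ofReal_toReal (ENNReal.div_ne_top hc hω0), ENNReal.div_mul_cancel hω0 hω]
  have hset : {x : EucN N | volume (Metric.ball (0 : EucN N) ‖x‖) < c} = Metric.ball 0 R := by
    ext x
    rw [mem_ball_zero_iff, Set.mem_ofPred_eq]
    constructor
    · intro h
      by_contra! hle
      exact h.not_ge (hRc ▸ measure_mono (Metric.ball_subset_ball hle))
    · intro h
      rw [← hRc, hball _ (norm_nonneg x), hball R hR]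
      exact ENNReal.mul_lt_mul_left hω0 hω ((ENNReal.ofReal_lt_ofReal_iff
        (pow_pos ((norm_nonneg x).trans_lt h) N)).2 (pow_lt_pow_left₀ h (norm_nonneg x) hN0))
  rw [hset, hRc]

theorem volume_Astar {N : ℕ} (hN : 1 ≤ N) {u v : EucN N → ℝ}
    (hu0 : VanishesAtInfinity u) (hv0 : VanishesAtInfinity v) {t : ℝ} (ht : 0 < t) :
    volume (Astar u v t) = volume {y | t < |u y|} + volume {y | t < |v y|} :=
  volume_setOf_volume_ball_norm_lt hN (ENNReal.add_ne_top.2 ⟨(hu0 t ht).ne, (hv0 t ht).ne⟩)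

theorem shibata_ne_top {N : ℕ} {u v : EucN N → ℝ} (hu : Measurable u) (hv : Measurable v)
    (hu0 : VanishesAtInfinity u) (hv0 : VanishesAtInfinity v) {x : EucN N} (hx : x ≠ 0) :
    shibata u v x ≠ ∞ := by
  have hlim := (tendsto_measure_superlevel_atTop volume hu.abs ⟨1, (hu0 1 one_pos).ne⟩).add
    (tendsto_measure_superlevel_atTop volume hv.abs ⟨1, (hv0 1 one_pos).ne⟩)
  rw [add_zero] at hlim
  obtain ⟨t, hlt, ht⟩ := ((hlim.eventually_lt_const
    (Metric.measure_ball_pos volume (0 : EucN N) (norm_pos_iff.2 hx))).and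
    (Filter.eventually_ge_atTop 0)).exists
  have hmem : x ∉ Astar u v t := hlt.not_gt
  rw [← ofReal_lt_shibata_iff u v x ht, not_lt] at hmem
  exact ne_top_of_le_ne_top ENNReal.ofReal_ne_top hmem

theorem shibata_lintegral_rpow
    (N : ℕ) (hN : 1 ≤ N) (u v : EucN N → ℝ)
    (hu : Measurable u) (hv : Measurable v)
    (hu0 : VanishesAtInfinity u) (hv0 : VanishesAtInfinity v)
    (p : ℝ) (hp : 1 ≤ p) :
    ∫⁻ x : EucN N, (shibata u v x) ^ p =
      (∫⁻ x : EucN N, (ENNReal.ofReal |u x|) ^ p) +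
        ∫⁻ x : EucN N, (ENNReal.ofReal |v x|) ^ p := by
  have : Nonempty (Fin N) := ⟨⟨0, hN⟩⟩
  have hp0 : 0 < p := one_pos.trans_le hp
  have hfin : ∀ᵐ x : EucN N, shibata u v x ≠ ∞ := by
    filter_upwards [compl_mem_ae_iff.2 (measure_singleton (μ := volume) (0 : EucN N))] with x hx
    exact shibata_ne_top hu hv hu0 hv0 hx
  have hlayer : ∀ w : EucN N → ℝ, Measurable w →
      ∫⁻ x, ENNReal.ofReal |w x| ^ p = ENNReal.ofReal p *
        ∫⁻ t in Set.Ioi (0 : ℝ), volume {x | t < |w x|} * ENNReal.ofReal (t ^ (p - 1)) := by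
    intro w hw
    rw [← lintegral_rpow_eq_lintegral_meas_lt_mul volume
      (Filter.Eventually.of_forall fun x => abs_nonneg (w x)) hw.abs.aemeasurable hp0]
    exact lintegral_congr fun x => ENNReal.ofReal_rpow_of_nonneg (abs_nonneg _) hp0.le
  have hshibata : ∫⁻ x, shibata u v x ^ p =
      ∫⁻ x, ENNReal.ofReal |(shibata u v x).toReal| ^ p := by
    refine lintegral_congr_ae ?_
    filter_upwards [hfin] with x hx
    rw [abs_of_nonneg ENNReal.toReal_nonneg, ENNReal.ofReal_toReal hx]
  rw [hshibata, hlayer _ (measurable_shibata u v).ennreal_toReal, hlayer u hu, hlayer v hv,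
    ← mul_add, ← lintegral_add_left]
  · congr 1
    refine setLIntegral_congr_fun measurableSet_Ioi fun t ht => ?_
    have ht0 : 0 < t := ht
    have hlevel : volume {x | t < |(shibata u v x).toReal|} = volume (Astar u v t) := by
      refine measure_congr ?_
      filter_upwards [hfin] with x hx
      refine propext ?_
      change t < |(shibata u v x).toReal| ↔ x ∈ Astar u v t
      rw [abs_of_nonneg ENNReal.toReal_nonneg, ← ofReal_lt_shibata_iff u v x ht0.le,
        ENNReal.ofReal_lt_iff_lt_toReal ht0.le hx]
    simp only [hlevel, volume_Astar hN hu0 hv0 ht0, add_mul]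
  · have hmono : Antitone fun t : ℝ => volume {x : EucN N | t < |u x|} := fun _ _ hst =>
      measure_mono fun _ hy => lt_of_le_of_lt hst hy
    exact hmono.measurable.mul (measurable_id.pow_const (p - 1)).ennreal_ofReal
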